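/- Let p be a prime, n an even positive integer, s a positive integer with s ≤ n/2, and let F : V_n → V_s be a vectorial dual-bent function satisfying Condition A with sign ε ∈ {1,−1} (ε = 1 if p = 2). Then the fiber partition {F⁻¹(i) : i ∈ V_s} is a bent partition of V_n satisfying Condition C with sign ε; explicitly: (a) F(a•x) = F(x) for every a ∈ (ZMod p)ˣ and every x ∈ V_n; and (b) for every g : V_s → ZMod p each of whose fibers g⁻¹(j), j ∈ ZMod p, has exactly p^{s−1} elements, the composite f = g ∘ F is weakly regular bent with sign ε. -/

import Mathlib

open Finset

/-- `ζ_p^t = exp(2πi·t.val/p)` for `t : ZMod p`. -/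
noncomputable def zetaP (p : ℕ) (t : ZMod p) : ℂ :=
  Complex.exp (2 * Real.pi * Complex.I * (t.val : ℂ) / (p : ℂ))

/-- The standard inner product on `V_n = Fin n → ZMod p`. -/
def ip {p n : ℕ} (a x : Fin n → ZMod p) : ZMod p := ∑ i, a i * x i

/-- The Walsh transform of `f : V_n → ZMod p`. -/
noncomputable def walsh {p n : ℕ} [NeZero p] (f : (Fin n → ZMod p) → ZMod p)
    (a : Fin n → ZMod p) : ℂ :=
  ∑ x : Fin n → ZMod p, zetaP p (f x - ip a x)

/-- `f : V_n → ZMod p` is weakly regular bent with sign `ε`. -/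
def WeaklyRegularBent {n : ℕ} (p : ℕ) [NeZero p]
    (f : (Fin n → ZMod p) → ZMod p) (ε : ℤ) : Prop :=
  ∃ fd : (Fin n → ZMod p) → ZMod p,
    ∀ a : Fin n → ZMod p, walsh f a = (ε : ℂ) * (p : ℂ) ^ (n / 2) * zetaP p (fd a)

/-- `F : V_n → V_s` is a vectorial dual-bent function satisfying Condition A with sign `ε`. -/
def ConditionA {n s : ℕ} (p : ℕ) [NeZero p]
    (F : (Fin n → ZMod p) → (Fin s → ZMod p)) (ε : ℤ) : Prop :=
  ∃ Fd : (Fin n → ZMod p) → (Fin s → ZMod p),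
    ∀ c : Fin s → ZMod p, c ≠ 0 → ∀ a : Fin n → ZMod p,
      walsh (fun x => ip c (F x)) a = (ε : ℂ) * (p : ℂ) ^ (n / 2) * zetaP p (ip c (Fd a))

theorem zetaP_eq_stdAddChar (p : ℕ) [NeZero p] (t : ZMod p) :
    zetaP p t = ZMod.stdAddChar t := by
  rw [ZMod.stdAddChar_apply, ZMod.toCircle_apply, zetaP]

theorem zetaP_add (p : ℕ) [NeZero p] (s t : ZMod p) :
    zetaP p (s + t) = zetaP p s * zetaP p t := by
  simp only [zetaP_eq_stdAddChar, AddChar.map_add_eq_mul]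

theorem zetaP_zero (p : ℕ) [NeZero p] : zetaP p 0 = 1 := by
  rw [zetaP_eq_stdAddChar, AddChar.map_zero_eq_one]

theorem zetaP_mul (p : ℕ) [NeZero p] (t u : ZMod p) :
    zetaP p (t * u) = zetaP p u ^ t.val := by
  rw [zetaP_eq_stdAddChar, zetaP_eq_stdAddChar, ← AddChar.map_nsmul_eq_pow, nsmul_eq_mul,
    ZMod.natCast_zmod_val]

theorem sum_zetaP (p : ℕ) [Fact p.Prime] : ∑ t : ZMod p, zetaP p t = 0 := by
  simp only [zetaP_eq_stdAddChar]
  refine AddChar.sum_eq_zero_of_ne_one ?_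
  have h := ZMod.isPrimitive_stdAddChar p (one_ne_zero)
  simpa using h

theorem isPrimitiveRoot_zetaP {p : ℕ} [Fact p.Prime] {u : ZMod p} (hu : u ≠ 0) :
    IsPrimitiveRoot (zetaP p u) p := by
  have hp : p.Prime := Fact.out
  have hpow : zetaP p u ^ p = 1 := by
    rw [zetaP_eq_stdAddChar, ← AddChar.map_nsmul_eq_pow, nsmul_eq_mul, CharP.cast_eq_zero,
      zero_mul, AddChar.map_zero_eq_one]
  have hne : zetaP p u ≠ 1 := by
    rw [zetaP_eq_stdAddChar, ← AddChar.map_zero_eq_one (ZMod.stdAddChar (N := p))]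
    exact fun h => hu (ZMod.injective_stdAddChar h)
  exact IsPrimitiveRoot.iff_orderOf.mpr (orderOf_eq_prime hpow hne)

theorem ip_comm {p n : ℕ} (a x : Fin n → ZMod p) : ip a x = ip x a := by
  simp only [ip, mul_comm]

theorem ip_add {p n : ℕ} (a x y : Fin n → ZMod p) : ip a (x + y) = ip a x + ip a y :=
  dotProduct_add a x y

theorem ip_sub {p n : ℕ} (a x y : Fin n → ZMod p) : ip a (x - y) = ip a x - ip a y :=
  dotProduct_sub a x y

theorem ip_smul {p n : ℕ} (u : ZMod p) (a x : Fin n → ZMod p) : ip a (u • x) = u * ip a x :=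
  dotProduct_smul u a x

theorem smul_ip {p n : ℕ} (u : ZMod p) (a x : Fin n → ZMod p) : ip (u • a) x = u * ip a x :=
  smul_dotProduct u a x

theorem neg_ip {p n : ℕ} (a x : Fin n → ZMod p) : ip (-a) x = -ip a x := neg_dotProduct a x

theorem ip_zero {p n : ℕ} (a : Fin n → ZMod p) : ip a 0 = 0 := dotProduct_zero a

theorem zero_ip {p n : ℕ} (a : Fin n → ZMod p) : ip 0 a = 0 := zero_dotProduct a

theorem sum_zetaP_ip {p n : ℕ} [Fact p.Prime] (y : Fin n → ZMod p) :
    ∑ x, zetaP p (ip x y) = if y = 0 then (p : ℂ) ^ n else 0 := by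
  simp only [zetaP_eq_stdAddChar, ip_comm _ y]
  split_ifs with hy
  · simp [hy, zero_ip]
  · let φ : (Fin n → ZMod p) →+ ZMod p := ⟨⟨ip y, ip_zero y⟩, ip_add y⟩
    refine AddChar.sum_eq_zero_of_ne_one (ψ := ZMod.stdAddChar.compAddMonoidHom φ) ?_
    obtain ⟨j, hj⟩ := Function.ne_iff.mp hy
    refine (AddChar.ne_one_iff).mpr ⟨Pi.single j 1, ?_⟩
    have h : φ (Pi.single j 1) = y j := by simp [φ, ip, Pi.single_apply]
    rw [AddChar.compAddMonoidHom_apply, h,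
      ← AddChar.map_zero_eq_one (ZMod.stdAddChar (N := p))]
    exact fun h => hj (ZMod.injective_stdAddChar h)

/-- A rational value of an exponential sum is invariant under the Galois action `ζ ↦ ζ ^ u`. -/
theorem sum_zetaP_mul_eq_of_rat {p : ℕ} [Fact p.Prime] {α : Type*} (A : Finset α)
    (φ : α → ZMod p) (q : ℚ) (h : ∑ x ∈ A, zetaP p (φ x) = q) {u : ZMod p} (hu : u ≠ 0) :
    ∑ x ∈ A, zetaP p (u * φ x) = q := by
  have hp : 0 < p := (Fact.out : p.Prime).pos
  let P : Polynomial ℚ := ∑ x ∈ A, Polynomial.X ^ (φ x).val - Polynomial.C q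
  have hP (v : ZMod p) :
      Polynomial.aeval (zetaP p v) P = ∑ x ∈ A, zetaP p (v * φ x) - (q : ℂ) := by
    simp [P, mul_comm v, zetaP_mul]
  have hdvd : minpoly ℚ (zetaP p 1) ∣ P := minpoly.dvd _ _ (by simp [hP, h])
  rw [← Polynomial.cyclotomic_eq_minpoly_rat (isPrimitiveRoot_zetaP one_ne_zero) hp,
    Polynomial.cyclotomic_eq_minpoly_rat (isPrimitiveRoot_zetaP hu) hp] at hdvd
  rw [← sub_eq_zero, ← hP]
  exact Polynomial.aeval_eq_zero_of_dvd_aeval_eq_zero hdvd (minpoly.aeval _ _)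

/-- The exponential sum at `a` over the fiber of `F` above `i`. -/
noncomputable def fiberSum {p n s : ℕ} [NeZero p] (F : (Fin n → ZMod p) → (Fin s → ZMod p))
    (i : Fin s → ZMod p) (a : Fin n → ZMod p) : ℂ :=
  ∑ x with F x = i, zetaP p (ip (-a) x)

theorem sum_zetaP_mul_walsh {p n s : ℕ} [Fact p.Prime]
    (F : (Fin n → ZMod p) → (Fin s → ZMod p)) (i : Fin s → ZMod p) (a : Fin n → ZMod p) :
    ∑ c, zetaP p (-ip c i) * walsh (fun x => ip c (F x)) a = (p : ℂ) ^ s * fiberSum F i a := by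
  have key (c : Fin s → ZMod p) (x : Fin n → ZMod p) :
      zetaP p (-ip c i) * zetaP p (ip c (F x) - ip a x) =
        zetaP p (ip c (F x - i)) * zetaP p (ip (-a) x) := by
    rw [← zetaP_add, ← zetaP_add, ip_sub, neg_ip]
    congr 1
    ring
  simp only [walsh, Finset.mul_sum, key]
  rw [Finset.sum_comm]
  simp only [← Finset.sum_mul, sum_zetaP_ip, sub_eq_zero, ite_mul, zero_mul]
  rw [← Finset.sum_filter, fiberSum, Finset.mul_sum]

/-- The fiber sums of a function satisfying Condition A, in terms of its dual `Fd`. -/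
theorem fiberSum_eq {p n s : ℕ} [Fact p.Prime]
    {F Fd : (Fin n → ZMod p) → (Fin s → ZMod p)} {ε : ℤ}
    (hFd : ∀ c : Fin s → ZMod p, c ≠ 0 → ∀ a : Fin n → ZMod p,
      walsh (fun x => ip c (F x)) a = (ε : ℂ) * (p : ℂ) ^ (n / 2) * zetaP p (ip c (Fd a)))
    (i : Fin s → ZMod p) (a : Fin n → ZMod p) :
    (p : ℂ) ^ s * fiberSum F i a =
      (if a = 0 then (p : ℂ) ^ n else 0) +
        (ε : ℂ) * (p : ℂ) ^ (n / 2) * ((if Fd a = i then (p : ℂ) ^ s else 0) - 1) := by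
  have hzero : walsh (fun x => ip (0 : Fin s → ZMod p) (F x)) a =
      if a = 0 then (p : ℂ) ^ n else 0 := by
    simp only [walsh, zero_ip, zero_sub, ← neg_ip, ip_comm (-a), sum_zetaP_ip, neg_eq_zero]
  have hc (c : Fin s → ZMod p) :
      zetaP p (-ip c i) * walsh (fun x => ip c (F x)) a =
        (if c = 0 then (if a = 0 then (p : ℂ) ^ n else 0) - (ε : ℂ) * (p : ℂ) ^ (n / 2) else 0) +
          (ε : ℂ) * (p : ℂ) ^ (n / 2) * zetaP p (ip c (Fd a - i)) := by
    by_cases h : c = 0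
    · subst h
      rw [hzero]
      simp [zero_ip, zetaP_zero]
    · rw [hFd c h, if_neg h, ip_sub, sub_eq_add_neg, zetaP_add]
      ring
  rw [← sum_zetaP_mul_walsh]
  simp only [hc]
  rw [Finset.sum_add_distrib, Finset.sum_ite_eq' univ (0 : Fin s → ZMod p), ← Finset.mul_sum,
    sum_zetaP_ip]
  simp only [mem_univ, if_true, sub_eq_zero]
  ring

theorem sum_fiberSum_mul_zetaP {p n s : ℕ} [Fact p.Prime]
    (F : (Fin n → ZMod p) → (Fin s → ZMod p)) (i : Fin s → ZMod p) (y : Fin n → ZMod p) :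
    ∑ a, fiberSum F i a * zetaP p (ip a y) = if F y = i then (p : ℂ) ^ n else 0 := by
  have key (a x : Fin n → ZMod p) :
      zetaP p (ip (-a) x) * zetaP p (ip a y) = zetaP p (ip a (y - x)) := by
    rw [← zetaP_add, ip_sub, neg_ip, neg_add_eq_sub]
  simp only [fiberSum, Finset.sum_mul, key]
  rw [Finset.sum_comm]
  simp only [sum_zetaP_ip, sub_eq_zero]
  simp [Finset.sum_ite_eq]

theorem walsh_comp {p n s : ℕ} [NeZero p] (F : (Fin n → ZMod p) → (Fin s → ZMod p))
    (g : (Fin s → ZMod p) → ZMod p) (a : Fin n → ZMod p) :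
    walsh (fun x => g (F x)) a = ∑ i, zetaP p (g i) * fiberSum F i a := by
  rw [walsh, ← Finset.sum_fiberwise univ F]
  refine Finset.sum_congr rfl fun i _ => ?_
  rw [fiberSum, Finset.mul_sum]
  refine Finset.sum_congr rfl fun x hx => ?_
  rw [(Finset.mem_filter.mp hx).2, sub_eq_add_neg, zetaP_add, neg_ip]

theorem sum_zetaP_comp_eq_zero {p : ℕ} [Fact p.Prime] {β : Type*} [Fintype β] {m : ℕ}
    {g : β → ZMod p} (hg : ∀ j : ZMod p, (Finset.univ.filter (fun i => g i = j)).card = m) :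
    ∑ i, zetaP p (g i) = 0 := by
  rw [← Finset.sum_fiberwise' univ g (zetaP p)]
  simp only [Finset.sum_const, hg]
  rw [← Finset.smul_sum, sum_zetaP, smul_zero]

theorem fiberSum_smul {p n s : ℕ} [Fact p.Prime]
    {F : (Fin n → ZMod p) → (Fin s → ZMod p)} {ε : ℤ} (hF : ConditionA p F ε)
    (u : (ZMod p)ˣ) (i : Fin s → ZMod p) (a : Fin n → ZMod p) :
    fiberSum F i ((u : ZMod p) • a) = fiberSum F i a := by
  obtain ⟨Fd, hFd⟩ := hF
  have hp : (p : ℂ) ^ s ≠ 0 := pow_ne_zero _ (NeZero.ne _)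
  obtain ⟨q, hq⟩ : ∃ q : ℚ, fiberSum F i a = q := by
    refine ⟨((if a = 0 then (p : ℚ) ^ n else 0) +
      ε * (p : ℚ) ^ (n / 2) * ((if Fd a = i then (p : ℚ) ^ s else 0) - 1)) / (p : ℚ) ^ s, ?_⟩
    push_cast
    rw [eq_div_iff hp, mul_comm, fiberSum_eq hFd]
    split_ifs <;> push_cast <;> rfl
  rw [hq]
  rw [fiberSum] at hq
  have h := sum_zetaP_mul_eq_of_rat _ _ q hq u.ne_zero
  simpa only [fiberSum, ← smul_neg, smul_ip] using h

theorem stmt1 (p : ℕ) [Fact p.Prime] (n s : ℕ) (hn : 0 < n) (hneven : Even n)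
    (hs : 0 < s) (hsn : s ≤ n / 2)
    (F : (Fin n → ZMod p) → (Fin s → ZMod p)) (ε : ℤ)
    (hε : ε = 1 ∨ ε = -1) (hε2 : p = 2 → ε = 1)
    (hF : ConditionA p F ε) :
    (∀ (a : (ZMod p)ˣ) (x : Fin n → ZMod p), F ((a : ZMod p) • x) = F x) ∧
      ∀ g : (Fin s → ZMod p) → ZMod p,
        (∀ j : ZMod p, (Finset.univ.filter (fun i => g i = j)).card = p ^ (s - 1)) →
        WeaklyRegularBent p (fun x => g (F x)) ε := by
  refine ⟨fun u x => ?_, fun g hg => ?_⟩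
  · have h : ∑ a, fiberSum F (F x) a * zetaP p (ip a ((u : ZMod p) • x)) =
        ∑ a, fiberSum F (F x) a * zetaP p (ip a x) := by
      refine Fintype.sum_equiv (MulAction.toPerm u) _ _ fun a => ?_
      rw [MulAction.toPerm_apply, Units.smul_def, fiberSum_smul hF, ip_smul, smul_ip]
    rw [sum_fiberSum_mul_zetaP, sum_fiberSum_mul_zetaP, if_pos rfl] at h
    by_contra hne
    rw [if_neg hne] at h
    exact pow_ne_zero n (NeZero.ne (p : ℂ)) h.symm
  · obtain ⟨Fd, hFd⟩ := hF
    refine ⟨fun a => g (Fd a), fun a => ?_⟩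
    have hp : (p : ℂ) ^ s ≠ 0 := pow_ne_zero _ (NeZero.ne _)
    refine mul_left_cancel₀ hp ?_
    have hi (i : Fin s → ZMod p) : (p : ℂ) ^ s * (zetaP p (g i) * fiberSum F i a) =
        zetaP p (g i) *
            ((if a = 0 then (p : ℂ) ^ n else 0) - (ε : ℂ) * (p : ℂ) ^ (n / 2)) +
          if Fd a = i then (p : ℂ) ^ s * ((ε : ℂ) * (p : ℂ) ^ (n / 2) * zetaP p (g i)) else 0 := by
      rw [mul_left_comm, fiberSum_eq hFd]
      split_ifs <;> ring
    rw [walsh_comp, Finset.mul_sum]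
    simp only [hi]
    rw [Finset.sum_add_distrib, ← Finset.sum_mul, sum_zetaP_comp_eq_zero hg]
    simp
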